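/- Let A be a bridge-addable class of graphs with growth constant γ_A, and let t = t(n) → ∞ as n → ∞ with t(n) = o(n). Let A^t be the class of graphs G in A such that every cycle of G has length at most t(n), where n = v(G). Suppose moreover that A is closed under taking disjoint unions with adding connecting bridges (i.e., joining graphs in A along bridges yields graphs in A). Then A^t has growth constant γ_A, i.e., (|A^t_n|/n!)^{1/n} → γ_A. -/

import Mathlib

open Filter

/-- Membership of a graph `H` in an isomorphism-closed class `A`. -/
def memClass (𝒜 : ∀ m : ℕ, Set (SimpleGraph (Fin m))) {V : Type*} (H : SimpleGraph V) : Prop :=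
  ∃ H' ∈ 𝒜 (Nat.card V), Nonempty (H ≃g H')

/-- Add the edge `uv` to `G`. -/
def addEdge {V : Type*} (G : SimpleGraph V) (u v : V) : SimpleGraph V :=
  G ⊔ SimpleGraph.fromEdgeSet {s(u, v)}

theorem addEdge_adj {V : Type*} (G : SimpleGraph V) (u v x y : V) :
    (addEdge G u v).Adj x y ↔ G.Adj x y ∨ (s(x, y) = s(u, v) ∧ x ≠ y) := by
  simp [addEdge, SimpleGraph.sup_adj, SimpleGraph.fromEdgeSet_adj]

theorem reach_of_local {V : Type*} {G H : SimpleGraph V} {r x : V} (h : G.Reachable r x)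
    (hl : ∀ a b, G.Reachable r a → G.Adj a b → H.Adj a b) : H.Reachable r x := by
  rw [SimpleGraph.reachable_iff_reflTransGen] at h
  induction h with
  | refl => exact SimpleGraph.Reachable.refl _
  | tail hab hbc ih =>
    exact ih.trans (hl _ _ ((SimpleGraph.reachable_iff_reflTransGen _ _).2 hab) hbc).reachable

theorem addEdge_inj_aux {V : Type*} {G₁ G₂ : SimpleGraph V} {r u₁ u₂ v : V}
    (h₁ : G₁.Reachable r u₁) (n₁ : ¬ G₁.Reachable r v)
    (h₂ : G₂.Reachable r u₂) (n₂ : ¬ G₂.Reachable r v)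
    (he : addEdge G₁ u₁ v = addEdge G₂ u₂ v) : u₁ = u₂ ∧ G₁ = G₂ := by
  have hadj : ∀ x y, (addEdge G₁ u₁ v).Adj x y ↔ (addEdge G₂ u₂ v).Adj x y := by
    intro x y; rw [he]
  simp only [addEdge_adj] at hadj
  have hne : u₁ ≠ v := by rintro rfl; exact n₁ h₁
  have hr : G₂.Reachable r u₁ := by
    refine reach_of_local h₁ ?_
    intro a b ha hab
    rcases (hadj a b).1 (Or.inl hab) with h | ⟨h, -⟩
    · exact h
    · exfalso
      have hb : G₁.Reachable r b := ha.trans hab.reachable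
      rcases Sym2.eq_iff.1 h with ⟨_, rfl⟩ | ⟨rfl, _⟩
      · exact n₁ hb
      · exact n₁ ha
  have hu : u₁ = u₂ := by
    rcases (hadj u₁ v).1 (Or.inr ⟨rfl, hne⟩) with h | ⟨h, -⟩
    · exact absurd (hr.trans h.reachable) n₂
    · rcases Sym2.eq_iff.1 h with ⟨h, _⟩ | ⟨h, _⟩
      · exact h
      · exact absurd h hne
  subst hu
  refine ⟨rfl, ?_⟩
  have k₁ : ¬ G₁.Adj u₁ v := fun h => n₁ (h₁.trans h.reachable)
  have k₂ : ¬ G₂.Adj u₁ v := fun h => n₂ (h₂.trans h.reachable)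
  have key : ∀ (G : SimpleGraph V) x y, ¬ G.Adj u₁ v → G.Adj x y → s(x, y) ≠ s(u₁, v) := by
    intro G x y hn hxy h
    rcases Sym2.eq_iff.1 h with ⟨rfl, rfl⟩ | ⟨rfl, rfl⟩
    · exact hn hxy
    · exact hn hxy.symm
  ext x y
  constructor
  · intro h
    rcases (hadj x y).1 (Or.inl h) with h' | ⟨h', -⟩
    · exact h'
    · exact absurd h' (key _ _ _ k₁ h)
  · intro h
    rcases (hadj x y).2 (Or.inl h) with h' | ⟨h', -⟩
    · exact h'
    · exact absurd h' (key _ _ _ k₂ h)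

theorem addEdge_ncard {n : ℕ} (G : SimpleGraph (Fin n)) (u v : Fin n) (huv : u ≠ v)
    (h : ¬ G.Adj u v) : (addEdge G u v).edgeSet.ncard = G.edgeSet.ncard + 1 := by
  have : (addEdge G u v).edgeSet = insert s(u, v) G.edgeSet := by
    ext e
    induction e with
    | _ x y =>
      simp only [SimpleGraph.mem_edgeSet, addEdge_adj, Set.mem_insert_iff]
      constructor
      · rintro (h | h)
        · exact Or.inr h
        · exact Or.inl h.1
      · rintro (h | h)
        · right
          refine ⟨h, ?_⟩
          rintro rfl
          rcases Sym2.eq_iff.1 h with ⟨rfl, rfl⟩ | ⟨rfl, rfl⟩ <;> exact huv rfl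
        · exact Or.inl h
  rw [this, Set.ncard_insert_of_notMem (by simpa using h) (Set.toFinite _)]

open Classical in
theorem step_count (n : ℕ) (A : Finset (SimpleGraph (Fin n))) (r : Fin n)
    (hba : ∀ G ∈ A, ∀ u v : Fin n, ¬ G.Reachable u v → addEdge G u v ∈ A) (j : ℕ) :
    (A.filter (fun G => ¬ G.Connected ∧ G.edgeSet.ncard = j)).card ≤
      (A.filter (fun G => G.edgeSet.ncard = j + 1)).card := by
  by_cases hn : (Finset.univ.erase r).card = 0
  · have : A.filter (fun G => ¬ G.Connected ∧ G.edgeSet.ncard = j) = ∅ := by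
      apply Finset.filter_eq_empty_iff.2
      rintro G - ⟨hc, -⟩
      apply hc
      have hall : ∀ x, x = r := by
        intro x
        by_contra hx
        have : x ∈ (Finset.univ.erase r) := by simp [hx]
        rw [Finset.card_eq_zero.1 hn] at this
        simp at this
      have : Nonempty (Fin n) := ⟨r⟩
      refine ⟨fun x y => ?_⟩
      rw [hall x, hall y]
    simp [this]
  have hex : ∀ G : SimpleGraph (Fin n), ∃ v, ¬ G.Connected → ¬ G.Reachable r v := by
    intro G
    by_contra hcon
    push Not at hcon
    refine (hcon r).1 ?_
    have : Nonempty (Fin n) := ⟨r⟩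
    exact ⟨fun x y => (hcon x).2.symm.trans (hcon y).2⟩
  choose v₀ hv₀ using hex
  let pu : SimpleGraph (Fin n) → Fin n → Fin n := fun G w => if G.Reachable r w then w else r
  let pv : SimpleGraph (Fin n) → Fin n → Fin n := fun G w => if G.Reachable r w then v₀ G else w
  have hpu : ∀ (G : SimpleGraph (Fin n)) (w : Fin n), G.Reachable r (pu G w) := by
    intro G w
    by_cases h : G.Reachable r w <;> simp [pu, h]
  have hpv : ∀ (G : SimpleGraph (Fin n)) (w : Fin n), ¬ G.Connected → ¬ G.Reachable r (pv G w) := by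
    intro G w hG
    by_cases h : G.Reachable r w
    · simpa [pv, h] using hv₀ G hG
    · simp [pv, h]
  have key := Finset.card_le_card_of_injOn
    (s := (A.filter (fun G => ¬ G.Connected ∧ G.edgeSet.ncard = j)) ×ˢ (Finset.univ.erase r))
    (t := (A.filter (fun G => G.edgeSet.ncard = j + 1)) ×ˢ (Finset.univ.erase r))
    (fun p => (addEdge p.1 (pu p.1 p.2) (pv p.1 p.2), pv p.1 p.2)) ?_ ?_
  · rw [Finset.card_product, Finset.card_product] at key
    exact Nat.le_of_mul_le_mul_right key (Nat.pos_of_ne_zero hn)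
  · rintro ⟨G, w⟩ h
    simp only [Finset.coe_product, Set.mem_prod, Finset.mem_coe, Finset.mem_filter,
      Finset.mem_erase, Finset.mem_univ, and_true] at h ⊢
    obtain ⟨⟨hA, hc, hj⟩, hw⟩ := h
    have h1 := hpu G w
    have h2 := hpv G w hc
    refine ⟨⟨hba G hA _ _ fun h => h2 (h1.trans h), ?_⟩, ?_⟩
    · rw [addEdge_ncard, hj]
      · intro h; rw [h] at h1; exact h2 h1
      · intro h; exact h2 (h1.trans h.reachable)
    · intro h; rw [h] at h2; exact h2 (SimpleGraph.Reachable.refl _)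
  · rintro ⟨G, w⟩ h ⟨G', w'⟩ h' heq
    simp only [Finset.coe_product, Set.mem_prod, Finset.mem_coe, Finset.mem_filter,
      Finset.mem_erase, Finset.mem_univ, and_true] at h h'
    simp only [Prod.mk.injEq] at heq
    obtain ⟨he, hv⟩ := heq
    rw [← hv] at he
    obtain ⟨hu, hG⟩ := addEdge_inj_aux (hpu G w) (hpv G w h.1.2.1) (hpu G' w')
      (by rw [hv]; exact hpv G' w' h'.1.2.1) he
    subst hG
    have hw : w ≠ r := h.2
    have hw' : w' ≠ r := h'.2
    by_cases a : G.Reachable r w <;> by_cases b : G.Reachable r w' <;> simp [pu, pv, a, b] at hu hv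
    · rw [hu]
    · exact absurd hu hw
    · exact absurd hu.symm hw'
    · rw [hv]

open Classical in
theorem conn_count (n : ℕ) (A : Finset (SimpleGraph (Fin n))) (r : Fin n)
    (hba : ∀ G ∈ A, ∀ u v : Fin n, ¬ G.Reachable u v → addEdge G u v ∈ A) :
    A.card ≤ (n * n + 2) * (A.filter (fun G => G.Connected)).card := by
  have hM : ∀ G : SimpleGraph (Fin n), G.edgeSet.ncard ≤ n * n := by
    intro G
    have h1 : G.edgeSet.ncard ≤ Nat.card (Sym2 (Fin n)) := Set.ncard_le_card _
    have h2 : Nat.card (Sym2 (Fin n)) ≤ Nat.card (Fin n × Fin n) :=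
      Nat.card_le_card_of_surjective (Quot.mk _) Quot.mk_surjective
    simp only [Nat.card_prod, Nat.card_fin] at h2
    exact h1.trans h2
  have hd : ∀ i j, n * n + 1 - j = i →
      (A.filter (fun G => ¬ G.Connected ∧ G.edgeSet.ncard = j)).card ≤
      (A.filter (fun G => G.Connected ∧ j < G.edgeSet.ncard)).card := by
    intro i
    induction i with
    | zero =>
      intro j hj
      have : A.filter (fun G => ¬ G.Connected ∧ G.edgeSet.ncard = j) = ∅ := by
        apply Finset.filter_eq_empty_iff.2
        rintro G - ⟨-, h⟩
        have := hM G
        omega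
      simp [this]
    | succ i ih =>
      intro j hj
      have h1 := step_count n A r hba j
      have h2 := ih (j + 1) (by omega)
      have h3 : (A.filter (fun G => G.edgeSet.ncard = j + 1)).card ≤
          (A.filter (fun G => ¬ G.Connected ∧ G.edgeSet.ncard = j + 1)).card +
          (A.filter (fun G => G.Connected ∧ G.edgeSet.ncard = j + 1)).card := by
        rw [← Finset.card_union_of_disjoint]
        · apply Finset.card_le_card
          intro G hG
          simp only [Finset.mem_filter, Finset.mem_union] at hG ⊢
          tauto
        · rw [Finset.disjoint_left]
          intro G hG hG'
          simp only [Finset.mem_filter] at hG hG'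
          tauto
      have h4 : (A.filter (fun G => G.Connected ∧ j + 1 < G.edgeSet.ncard)).card +
          (A.filter (fun G => G.Connected ∧ G.edgeSet.ncard = j + 1)).card ≤
          (A.filter (fun G => G.Connected ∧ j < G.edgeSet.ncard)).card := by
        rw [← Finset.card_union_of_disjoint]
        · apply Finset.card_le_card
          intro G hG
          simp only [Finset.mem_filter, Finset.mem_union] at hG ⊢
          rcases hG with ⟨a, b, c⟩ | ⟨a, b, c⟩
          · exact ⟨a, b, by omega⟩
          · exact ⟨a, b, by omega⟩
        · rw [Finset.disjoint_left]
          intro G hG hG'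
          simp only [Finset.mem_filter] at hG hG'
          omega
      omega
  have hd' : ∀ j, (A.filter (fun G => ¬ G.Connected ∧ G.edgeSet.ncard = j)).card ≤
      (A.filter (fun G => G.Connected)).card := by
    intro j
    refine (hd _ j rfl).trans (Finset.card_le_card ?_)
    intro G hG
    simp only [Finset.mem_filter] at hG ⊢
    tauto
  have hsum : (A.filter (fun G => ¬ G.Connected)).card ≤
      (n * n + 1) * (A.filter (fun G => G.Connected)).card := by
    rw [Finset.card_eq_sum_card_fiberwise (f := fun G => G.edgeSet.ncard)
      (t := Finset.range (n * n + 1))]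
    · refine (Finset.sum_le_card_nsmul _ _ (A.filter (fun G => G.Connected)).card ?_).trans ?_
      · intro j _
        rw [Finset.filter_filter]
        exact hd' j
      · simp
    · intro G _
      have := hM G
      simp
      omega
  have := Finset.card_filter_add_card_filter_not (s := A) (fun G => G.Connected)
  nlinarith

theorem memClass_of_iso (𝒜 : ∀ m : ℕ, Set (SimpleGraph (Fin m))) {V : Type*} (H : SimpleGraph V)
    {m : ℕ} (hm : Nat.card V = m) (G : SimpleGraph (Fin m)) (hG : G ∈ 𝒜 m)
    (h : Nonempty (H ≃g G)) : memClass 𝒜 H := by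
  subst hm
  exact ⟨G, hG, h⟩

theorem iso_induce {V W : Type*} (e : W ↪ V) (s : Set V) (hs : Set.range e = s)
    (H : SimpleGraph W) (G : SimpleGraph V) (h : ∀ a b, G.Adj (e a) (e b) ↔ H.Adj a b) :
    Nonempty (G.induce s ≃g H) := by
  subst hs
  refine ⟨SimpleGraph.Iso.symm ⟨Equiv.ofInjective e e.injective, ?_⟩⟩
  intro a b
  simpa using h a b

def cyc {V : Type*} (T : ℕ) (G : SimpleGraph V) : Prop :=
  ∀ (v : V) (c : G.Walk v v), c.IsCycle → c.length ≤ T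

theorem cyc_side {V W : Type*} {T : ℕ} (G : SimpleGraph V) (s : Set V) (H : SimpleGraph W)
    (hi : Nonempty (G.induce s ≃g H)) (hH : cyc T H)
    (hs : ∀ x ∈ s, ∀ y, G.Adj x y → y ∈ s) (v : V) (hv : v ∈ s) (c : G.Walk v v)
    (hc : c.IsCycle) : c.length ≤ T := by
  classical
  obtain ⟨f⟩ := hi
  have hr : ∀ x, G.Reachable v x → x ∈ s := by
    intro x hx
    rw [SimpleGraph.reachable_iff_reflTransGen] at hx
    induction hx with
    | refl => exact hv
    | tail _ h ih => exact hs _ ih _ h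
  have hsup : ∀ x ∈ c.support, x ∈ s := fun x hx => hr x ⟨c.takeUntil x hx⟩
  have hm := c.map_induce hsup
  have h1 : (c.induce s hsup).IsCycle :=
    (SimpleGraph.Walk.isCycle_map_iff_of_injective
      (f := (SimpleGraph.Embedding.induce (G := G) s).toHom)
      (SimpleGraph.Embedding.induce (G := G) s).injective).1
      ((congrArg (fun w : G.Walk v v => w.IsCycle) hm).mpr hc)
  have h2 : ((c.induce s hsup).map f.toHom).IsCycle := by
    rw [SimpleGraph.Walk.isCycle_map_iff_of_injective f.injective]
    exact h1
  have h3 := hH _ _ h2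
  have h4 : (c.induce s hsup).length = c.length :=
    (SimpleGraph.Walk.length_map _ _).symm.trans
      (congrArg (fun w : G.Walk v v => w.length) hm)
  rw [SimpleGraph.Walk.length_map] at h3
  omega

theorem cyc_addEdge {V : Type*} {T : ℕ} (G : SimpleGraph V) (u v : V) (h : ¬ G.Reachable u v)
    (hG : cyc T G) : cyc T (addEdge G u v) := by
  intro w c hc
  have hb : (addEdge G u v).IsBridge s(u, v) :=
    SimpleGraph.isBridge_sup_edge.mpr (SimpleGraph.IsBridge.of_not_reachable h)
  have hn := hb.notMem_edges_of_isCycle hc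
  have he : ∀ e ∈ c.edges, e ∈ G.edgeSet := by
    intro e he
    have h1 := c.edges_subset_edgeSet he
    induction e with
    | _ x y =>
      rw [SimpleGraph.mem_edgeSet, addEdge_adj] at h1
      rcases h1 with h1 | ⟨h1, -⟩
      · exact h1
      · rw [h1] at he; exact absurd he hn
  have := hG w (c.transfer G he) (hc.transfer he)
  simpa using this

section joinsec

variable {N m k : ℕ} (e₁ : Fin m ↪ Fin N) (e₂ : Fin k ↪ Fin N)
  (G₁ : SimpleGraph (Fin m)) (G₂ : SimpleGraph (Fin k))

def joinBase : SimpleGraph (Fin N) := G₁.map e₁ ⊔ G₂.map e₂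

theorem joinBase_left (d : ∀ a b, e₁ a ≠ e₂ b) (a b : Fin m) :
    (joinBase e₁ e₂ G₁ G₂).Adj (e₁ a) (e₁ b) ↔ G₁.Adj a b := by
  simp only [joinBase, SimpleGraph.sup_adj, SimpleGraph.map_adj]
  constructor
  · rintro (⟨x, y, h, hx, hy⟩ | ⟨x, y, h, hx, hy⟩)
    · rwa [← e₁.injective hx, ← e₁.injective hy]
    · exact absurd hx.symm (d _ _)
  · intro h; exact Or.inl ⟨a, b, h, rfl, rfl⟩

theorem joinBase_right (d : ∀ a b, e₁ a ≠ e₂ b) (a b : Fin k) :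
    (joinBase e₁ e₂ G₁ G₂).Adj (e₂ a) (e₂ b) ↔ G₂.Adj a b := by
  simp only [joinBase, SimpleGraph.sup_adj, SimpleGraph.map_adj]
  constructor
  · rintro (⟨x, y, h, hx, hy⟩ | ⟨x, y, h, hx, hy⟩)
    · exact absurd hx (d _ _)
    · rwa [← e₂.injective hx, ← e₂.injective hy]
  · intro h; exact Or.inr ⟨a, b, h, rfl, rfl⟩

theorem joinBase_cross (d : ∀ a b, e₁ a ≠ e₂ b) (a : Fin m) (b : Fin k) :
    ¬ (joinBase e₁ e₂ G₁ G₂).Adj (e₁ a) (e₂ b) := by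
  simp only [joinBase, SimpleGraph.sup_adj, SimpleGraph.map_adj]
  rintro (⟨x, y, h, hx, hy⟩ | ⟨x, y, h, hx, hy⟩)
  · exact absurd hy (d _ _)
  · exact absurd hx.symm (d _ _)

theorem joinAll_left (d : ∀ a b, e₁ a ≠ e₂ b) (u : Fin m) (v : Fin k) (a b : Fin m) :
    (addEdge (joinBase e₁ e₂ G₁ G₂) (e₁ u) (e₂ v)).Adj (e₁ a) (e₁ b) ↔ G₁.Adj a b := by
  rw [addEdge_adj, joinBase_left _ _ _ _ d]
  constructor
  · rintro (h | ⟨h, -⟩)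
    · exact h
    · rcases Sym2.eq_iff.1 h with ⟨_, h⟩ | ⟨h, _⟩ <;> exact absurd h (d _ _)
  · exact Or.inl

theorem joinAll_right (d : ∀ a b, e₁ a ≠ e₂ b) (u : Fin m) (v : Fin k) (a b : Fin k) :
    (addEdge (joinBase e₁ e₂ G₁ G₂) (e₁ u) (e₂ v)).Adj (e₂ a) (e₂ b) ↔ G₂.Adj a b := by
  rw [addEdge_adj, joinBase_right _ _ _ _ d]
  constructor
  · rintro (h | ⟨h, -⟩)
    · exact h
    · rcases Sym2.eq_iff.1 h with ⟨h, _⟩ | ⟨_, h⟩ <;> exact absurd h.symm (d _ _)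
  · exact Or.inl

theorem joinAll_cross (d : ∀ a b, e₁ a ≠ e₂ b) (u : Fin m) (v : Fin k) (a : Fin m) (b : Fin k) :
    (addEdge (joinBase e₁ e₂ G₁ G₂) (e₁ u) (e₂ v)).Adj (e₁ a) (e₂ b) ↔ a = u ∧ b = v := by
  rw [addEdge_adj]
  constructor
  · rintro (h | ⟨h, -⟩)
    · exact absurd h (joinBase_cross _ _ _ _ d _ _)
    · rcases Sym2.eq_iff.1 h with ⟨h, h'⟩ | ⟨h, _⟩
      · exact ⟨e₁.injective h, e₂.injective h'⟩
      · exact absurd h (d _ _)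
  · rintro ⟨rfl, rfl⟩
    exact Or.inr ⟨rfl, d _ _⟩

theorem joinAll_connected (d : ∀ a b, e₁ a ≠ e₂ b) (cov : ∀ x, (∃ a, e₁ a = x) ∨ ∃ b, e₂ b = x)
    (h₁ : G₁.Connected) (h₂ : G₂.Connected) (u : Fin m) (v : Fin k) :
    (addEdge (joinBase e₁ e₂ G₁ G₂) (e₁ u) (e₂ v)).Connected := by
  have : Nonempty (Fin N) := ⟨e₁ u⟩
  have key : ∀ x, (addEdge (joinBase e₁ e₂ G₁ G₂) (e₁ u) (e₂ v)).Reachable (e₁ u) x := by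
    intro x
    rcases cov x with ⟨a, rfl⟩ | ⟨b, rfl⟩
    · exact (h₁.preconnected u a).map
        (⟨e₁, fun {x y} h => (joinAll_left e₁ e₂ G₁ G₂ d u v x y).2 h⟩ : G₁ →g _)
    · refine SimpleGraph.Reachable.trans
        ((joinAll_cross e₁ e₂ G₁ G₂ d u v u v).2 ⟨rfl, rfl⟩).reachable ?_
      exact (h₂.preconnected v b).map
        (⟨e₂, fun {x y} h => (joinAll_right e₁ e₂ G₁ G₂ d u v x y).2 h⟩ : G₂ →g _)
  exact ⟨fun x y => (key x).symm.trans (key y)⟩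

theorem joinBase_stay_left (d : ∀ a b, e₁ a ≠ e₂ b)
    (cov : ∀ x, (∃ a, e₁ a = x) ∨ ∃ b, e₂ b = x) :
    ∀ x ∈ Set.range e₁, ∀ y, (joinBase e₁ e₂ G₁ G₂).Adj x y → y ∈ Set.range e₁ := by
  rintro _ ⟨a, rfl⟩ y h
  rcases cov y with h' | ⟨b, rfl⟩
  · exact h'
  · exact absurd h (joinBase_cross _ _ _ _ d _ _)

theorem joinBase_stay_right (d : ∀ a b, e₁ a ≠ e₂ b)
    (cov : ∀ x, (∃ a, e₁ a = x) ∨ ∃ b, e₂ b = x) :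
    ∀ x ∈ Set.range e₂, ∀ y, (joinBase e₁ e₂ G₁ G₂).Adj x y → y ∈ Set.range e₂ := by
  rintro _ ⟨a, rfl⟩ y h
  rcases cov y with ⟨b, rfl⟩ | h'
  · exact absurd h.symm (joinBase_cross _ _ _ _ d _ _)
  · exact h'

theorem joinAll_cyc (T : ℕ) (d : ∀ a b, e₁ a ≠ e₂ b)
    (cov : ∀ x, (∃ a, e₁ a = x) ∨ ∃ b, e₂ b = x)
    (h₁ : cyc T G₁) (h₂ : cyc T G₂) (u : Fin m) (v : Fin k) :
    cyc T (addEdge (joinBase e₁ e₂ G₁ G₂) (e₁ u) (e₂ v)) := by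
  apply cyc_addEdge
  · intro h
    have : e₂ v ∈ Set.range e₁ := by
      rw [SimpleGraph.reachable_iff_reflTransGen] at h
      generalize e₂ v = z at h
      induction h with
      | refl => exact ⟨u, rfl⟩
      | tail _ h ih => exact joinBase_stay_left e₁ e₂ G₁ G₂ d cov _ ih _ h
    obtain ⟨a, ha⟩ := this
    exact d _ _ ha
  · intro w c hc
    rcases cov w with h | h
    · exact cyc_side _ (Set.range e₁) G₁
        (iso_induce e₁ _ rfl _ _ (joinBase_left e₁ e₂ G₁ G₂ d)) h₁
        (joinBase_stay_left e₁ e₂ G₁ G₂ d cov) w h c hc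
    · exact cyc_side _ (Set.range e₂) G₂
        (iso_induce e₂ _ rfl _ _ (joinBase_right e₁ e₂ G₁ G₂ d)) h₂
        (joinBase_stay_right e₁ e₂ G₁ G₂ d cov) w h c hc

theorem joinAll_mem (𝒜 : ∀ n : ℕ, Set (SimpleGraph (Fin n)))
    (hjoin : ∀ (n : ℕ) (G : SimpleGraph (Fin n)) (S : Finset (Fin n)) (u v : Fin n),
      u ∈ S → v ∉ S → (∀ x ∈ S, ∀ y, y ∉ S → ¬ G.Adj x y) →
      memClass 𝒜 (G.induce (S : Set (Fin n))) →
      memClass 𝒜 (G.induce ((S : Set (Fin n))ᶜ)) →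
      addEdge G u v ∈ 𝒜 n)
    (d : ∀ a b, e₁ a ≠ e₂ b)
    (cov : ∀ x, (∃ a, e₁ a = x) ∨ ∃ b, e₂ b = x)
    (h₁ : G₁ ∈ 𝒜 m) (h₂ : G₂ ∈ 𝒜 k) (u : Fin m) (v : Fin k) :
    addEdge (joinBase e₁ e₂ G₁ G₂) (e₁ u) (e₂ v) ∈ 𝒜 N := by
  have r1 : Set.range e₁ = ((Finset.univ.map e₁ : Finset (Fin N)) : Set (Fin N)) := by
    ext x; simp
  have r2 : Set.range e₂ = ((Finset.univ.map e₁ : Finset (Fin N)) : Set (Fin N))ᶜ := by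
    rw [← r1]
    ext x
    constructor
    · rintro ⟨b, rfl⟩ ⟨a, ha⟩; exact d _ _ ha
    · intro h; exact (cov x).resolve_left h
  refine hjoin N _ (Finset.univ.map e₁) _ _ (by simp) ?_ ?_ ?_ ?_
  · simp only [Finset.mem_map, Finset.mem_univ, true_and, not_exists]
    exact fun a h => d _ _ h
  · intro x hx y hy h
    have hx' : x ∈ Set.range e₁ := by rw [r1]; exact hx
    have := joinBase_stay_left e₁ e₂ G₁ G₂ d cov x hx' y h
    rw [r1] at this
    exact hy this
  · refine memClass_of_iso 𝒜 _ ?_ G₁ h₁ (iso_induce e₁ _ r1 _ _ (joinBase_left e₁ e₂ G₁ G₂ d))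
    rw [← r1, Nat.card_range_of_injective e₁.injective, Nat.card_fin]
  · refine memClass_of_iso 𝒜 _ ?_ G₂ h₂ (iso_induce e₂ _ r2 _ _ (joinBase_right e₁ e₂ G₁ G₂ d))
    rw [← r2, Nat.card_range_of_injective e₂.injective, Nat.card_fin]

end joinsec

/-- A block containing the attachment vertex is determined by the graph. -/
theorem block_unique {N : ℕ} (G : SimpleGraph (Fin N)) (S S' : Finset (Fin N)) (u : Fin N)
    (hu : u ∈ S) (hcard : S.card = S'.card) (hN : 2 * S.card < N)
    (hcon : ∀ P : Set (Fin N), ∀ x y, x ∉ S → y ∉ S → x ∈ P → y ∉ P →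
      ∃ x y, x ∉ S ∧ y ∉ S ∧ x ∈ P ∧ y ∉ P ∧ G.Adj x y)
    (hcut : ∀ x ∈ S', ∀ y, y ∉ S' → G.Adj x y → x = u) : S = S' := by
  symm
  apply Finset.eq_of_subset_of_card_le ?_ hcard.le
  by_contra hsub
  obtain ⟨x, hx', hx⟩ := Finset.not_subset.1 hsub
  have : ∃ y, y ∉ S ∪ S' := by
    by_contra hall
    push Not at hall
    have h1 : (S ∪ S').card = N := by
      rw [Finset.eq_univ_iff_forall.2 hall, Finset.card_univ, Fintype.card_fin]
    have := Finset.card_union_le S S'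
    omega
  obtain ⟨y, hy⟩ := this
  simp only [Finset.mem_union, not_or] at hy
  obtain ⟨a, b, ha, hb, haP, hbP, hab⟩ := hcon (S' : Set (Fin N)) x y hx hy.1 hx' hy.2
  have := hcut a haP b hbP hab
  subst this
  exact ha hu

open Classical in
noncomputable def B (𝒜 : ∀ n : ℕ, Set (SimpleGraph (Fin n))) (T n : ℕ) :
    Finset (SimpleGraph (Fin n)) :=
  Finset.univ.filter (fun G => G ∈ 𝒜 n ∧ G.Connected ∧ cyc T G)

theorem join_count (𝒜 : ∀ n : ℕ, Set (SimpleGraph (Fin n)))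
    (hjoin : ∀ (n : ℕ) (G : SimpleGraph (Fin n)) (S : Finset (Fin n)) (u v : Fin n),
      u ∈ S → v ∉ S → (∀ x ∈ S, ∀ y, y ∉ S → ¬ G.Adj x y) →
      memClass 𝒜 (G.induce (S : Set (Fin n))) →
      memClass 𝒜 (G.induce ((S : Set (Fin n))ᶜ)) →
      addEdge G u v ∈ 𝒜 n) (T m k : ℕ) (hm : 0 < m) (hmk : m < k) :
    (m + k).choose m * ((B 𝒜 T m).card * ((B 𝒜 T k).card * k)) ≤
      (B 𝒜 T (m + k)).card * (m + k) := by
  classical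
  have hemb : ∀ S : Finset (Fin (m + k)), ∃ e : (Fin m ↪ Fin (m + k)) × (Fin k ↪ Fin (m + k)),
      S.card = m → Set.range e.1 = (S : Set _) ∧ Set.range e.2 = (S : Set _)ᶜ := by
    intro S
    by_cases h : S.card = m
    · have h' : Sᶜ.card = k := by rw [Finset.card_compl, h, Fintype.card_fin]; omega
      refine ⟨⟨(S.orderEmbOfFin h).toEmbedding, (Sᶜ.orderEmbOfFin h').toEmbedding⟩, fun _ => ?_⟩
      constructor
      · simp
      · simp
    · exact ⟨⟨Fin.castAddEmb k, Fin.natAddEmb m⟩, fun h' => absurd h' h⟩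
  choose e he using hemb
  have hd : ∀ S : Finset (Fin (m + k)), S.card = m → ∀ a b, (e S).1 a ≠ (e S).2 b := by
    intro S hS a b hab
    have h1 : (e S).1 a ∈ (S : Set (Fin (m + k))) := by rw [← (he S hS).1]; exact ⟨a, rfl⟩
    have h2 : (e S).2 b ∈ (S : Set (Fin (m + k)))ᶜ := by rw [← (he S hS).2]; exact ⟨b, rfl⟩
    rw [hab] at h1
    exact h2 h1
  have hmem : ∀ S : Finset (Fin (m + k)), S.card = m → ∀ x, x ∈ S ↔ ∃ a, (e S).1 a = x := by
    intro S hS x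
    rw [← Finset.mem_coe, ← (he S hS).1]; rfl
  have hnmem : ∀ S : Finset (Fin (m + k)), S.card = m → ∀ x, x ∉ S ↔ ∃ a, (e S).2 a = x := by
    intro S hS x
    rw [← Finset.mem_coe, ← Set.mem_compl_iff, ← (he S hS).2]; rfl
  have hcov : ∀ S : Finset (Fin (m + k)), S.card = m →
      ∀ x, (∃ a, (e S).1 a = x) ∨ ∃ b, (e S).2 b = x := by
    intro S hS x
    rw [← hmem S hS, ← hnmem S hS]; exact em _
  let z : Fin m := ⟨0, hm⟩
  have key := Finset.card_le_card_of_injOn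
    (s := (Finset.powersetCard m (Finset.univ : Finset (Fin (m + k)))) ×ˢ
      ((B 𝒜 T m) ×ˢ ((B 𝒜 T k) ×ˢ (Finset.univ : Finset (Fin k)))))
    (t := (B 𝒜 T (m + k)) ×ˢ (Finset.univ : Finset (Fin (m + k))))
    (fun p => (addEdge (joinBase (e p.1).1 (e p.1).2 p.2.1 p.2.2.1) ((e p.1).1 z)
      ((e p.1).2 p.2.2.2), (e p.1).1 z)) ?_ ?_
  · simpa [Finset.card_product, Finset.card_powersetCard] using key
  · rintro ⟨S, G₁, G₂, v⟩ h
    simp only [Finset.coe_product, Set.mem_prod, Finset.mem_coe, Finset.mem_powersetCard,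
      Finset.subset_univ, true_and, B, Finset.mem_filter, Finset.mem_univ, and_true] at h ⊢
    obtain ⟨hS, ⟨a1, a2, a3⟩, b1, b2, b3⟩ := h
    exact ⟨joinAll_mem _ _ _ _ 𝒜 hjoin (hd S hS) (hcov S hS) a1 b1 _ _,
      joinAll_connected _ _ _ _ (hd S hS) (hcov S hS) a2 b2 _ _,
      joinAll_cyc _ _ _ _ T (hd S hS) (hcov S hS) a3 b3 _ _⟩
  · rintro ⟨S, G₁, G₂, v⟩ h ⟨S', G₁', G₂', v'⟩ h' heq
    simp only [Finset.coe_product, Set.mem_prod, Finset.mem_coe, Finset.mem_powersetCard,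
      Finset.subset_univ, true_and, B, Finset.mem_filter, Finset.mem_univ, and_true] at h h'
    obtain ⟨hS, ⟨a1, a2, a3⟩, b1, b2, b3⟩ := h
    obtain ⟨hS', ⟨a1', a2', a3'⟩, b1', b2', b3'⟩ := h'
    simp only [Prod.mk.injEq] at heq
    obtain ⟨hG, hz⟩ := heq
    have hSS : S = S' := by
      refine block_unique (addEdge (joinBase (e S).1 (e S).2 G₁ G₂) ((e S).1 z) ((e S).2 v))
        S S' ((e S).1 z) ((hmem S hS _).2 ⟨z, rfl⟩) (hS.trans hS'.symm) (by omega) ?_ ?_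
      · intro P x y hx hy hxP hyP
        obtain ⟨x, rfl⟩ := (hnmem S hS _).1 hx
        obtain ⟨y, rfl⟩ := (hnmem S hS _).1 hy
        obtain ⟨p⟩ := b2.preconnected x y
        obtain ⟨dd, -, h1, h2⟩ := p.exists_boundary_dart ((e S).2 ⁻¹' P) hxP hyP
        exact ⟨(e S).2 dd.fst, (e S).2 dd.snd, (hnmem S hS _).2 ⟨_, rfl⟩,
          (hnmem S hS _).2 ⟨_, rfl⟩, h1, h2, (joinAll_right _ _ _ _ (hd S hS) _ _ _ _).2 dd.adj⟩
      · intro x hx y hy hxy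
        rw [hG] at hxy
        obtain ⟨x, rfl⟩ := (hmem S' hS' _).1 hx
        obtain ⟨y, rfl⟩ := (hnmem S' hS' _).1 hy
        rw [hz, ((joinAll_cross _ _ _ _ (hd S' hS') _ _ _ _).1 hxy).1]
    subst hSS
    have e1 : G₁ = G₁' := by
      ext a b
      rw [← joinAll_left _ _ G₁ G₂ (hd S hS) z v a b, hG, joinAll_left _ _ _ _ (hd S hS)]
    have e2 : G₂ = G₂' := by
      ext a b
      rw [← joinAll_right _ _ G₁ G₂ (hd S hS) z v a b, hG, joinAll_right _ _ _ _ (hd S hS)]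
    have e3 : v = v' := by
      have := (joinAll_cross _ _ G₁ G₂ (hd S hS) z v z v).2 ⟨rfl, rfl⟩
      rw [hG, joinAll_cross _ _ _ _ (hd S hS)] at this
      exact this.2
    rw [e1, e2, e3]

theorem cyc_of_le {n T : ℕ} (h : n ≤ T) (G : SimpleGraph (Fin n)) : cyc T G := by
  intro v c hc
  have h1 := hc.support_nodup.length_le_card
  rw [List.length_tail, SimpleGraph.Walk.length_support, Fintype.card_fin] at h1
  omega

theorem real_core (f : ℕ → ℝ) (x : ℝ) (hx : 0 < x) (m : ℕ) (hm : 0 < m)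
    (h0 : ∀ k, m ≤ k → k ≤ 2 * m → 2 * x ^ k ≤ f k)
    (hstep : ∀ k, m < k → f m * f k ≤ 2 * f (m + k)) :
    ∀ n, m < n → x ^ n ≤ f n := by
  intro n
  induction n using Nat.strong_induction_on with
  | _ n ih =>
    intro hn
    by_cases h : n ≤ 2 * m
    · have := h0 n hn.le h
      have := pow_pos hx n
      linarith
    · obtain ⟨k, rfl⟩ : ∃ k, n = m + k := ⟨n - m, by omega⟩
      have h1 := ih k (by omega) (by omega)
      have h2 := hstep k (by omega)
      have h3 := h0 m le_rfl (by omega)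
      have p1 := pow_pos hx m
      have p2 := pow_pos hx k
      have h4 : 2 * x ^ m * x ^ k ≤ f m * f k := mul_le_mul h3 h1 p2.le (by linarith)
      rw [pow_add]
      linarith

theorem join_real (b : ℕ → ℕ) (m k : ℕ) (hmk : m < k)
    (h : (m + k).choose m * (b m * (b k * k)) ≤ b (m + k) * (m + k)) :
    ((b m : ℝ) / m.factorial) * ((b k : ℝ) / k.factorial) ≤
      2 * ((b (m + k) : ℝ) / (m + k).factorial) := by
  have hk : (0 : ℝ) < k := by exact_mod_cast (by omega : 0 < k)
  have hmk' : (m : ℝ) < k := by exact_mod_cast hmk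
  have h' : ((m + k).choose m : ℝ) * (b m * (b k * k)) ≤ b (m + k) * (m + k) := by
    exact_mod_cast h
  have h2 : ((m + k).choose m : ℝ) * (b m * b k) ≤ 2 * b (m + k) := by
    have hb : (0 : ℝ) ≤ b (m + k) := Nat.cast_nonneg _
    have : ((m + k).choose m : ℝ) * (b m * b k) * k ≤ 2 * b (m + k) * k := by nlinarith
    exact le_of_mul_le_mul_right this hk
  have hf : ((m + k).choose m : ℝ) * (m.factorial * k.factorial) = (m + k).factorial := by
    have := Nat.add_choose_mul_factorial_mul_factorial m k
    rw [← Nat.choose_symm_add] at this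
    rw [mul_assoc] at this
    exact_mod_cast this
  have f1 : (0 : ℝ) < m.factorial := by exact_mod_cast m.factorial_pos
  have f2 : (0 : ℝ) < k.factorial := by exact_mod_cast k.factorial_pos
  have f3 : (0 : ℝ) < (m + k).factorial := by exact_mod_cast (m + k).factorial_pos
  have fc : (0 : ℝ) < (m + k).choose m := by
    exact_mod_cast Nat.choose_pos (by omega)
  rw [div_mul_div_comm, ← mul_div_assoc, ← hf, div_le_div_iff₀ (by positivity) (by positivity)]
  have f12 : (0 : ℝ) < m.factorial * k.factorial := by positivity
  nlinarith [mul_le_mul_of_nonneg_right h2 f12.le]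

theorem poly_exp (x y : ℝ) (hx : 0 < x) (hxy : x < y) :
    ∀ᶠ n : ℕ in atTop, 2 * x ^ n * ((n : ℝ) * n + 2) ≤ y ^ n := by
  have hy : 0 < y := hx.trans hxy
  have hr : x / y < 1 := (div_lt_one hy).2 hxy
  have hr0 : 0 ≤ x / y := by positivity
  have t1 := tendsto_pow_const_mul_const_pow_of_lt_one 2 hr0 hr
  have t2 := tendsto_pow_const_mul_const_pow_of_lt_one 0 hr0 hr
  have t := (t1.const_mul 2).add (t2.const_mul 4)
  simp only [mul_zero, add_zero] at t
  filter_upwards [t.eventually (gt_mem_nhds (zero_lt_one))] with n hn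
  have hyn : 0 < y ^ n := pow_pos hy n
  rw [div_pow] at hn
  have : (2 * x ^ n * ((n : ℝ) * n + 2)) / y ^ n < 1 := by
    refine lt_of_eq_of_lt ?_ hn
    field_simp
    ring
  exact ((div_lt_one hyn).1 this).le

/-- let `A` be a bridge-addable class with growth constant `γ_A`, closed under
isomorphism and under joining two `A`-graphs by a bridge, and let `t(n) → ∞` with
`t(n) = o(n)`. Then the class `A^t` of graphs `G ∈ A` all of whose cycles have length at
most `t(v(G))` has growth constant `γ_A`: `(|A^t_n|/n!)^{1/n} → γ_A`. -/
theorem stmt16 (𝒜 : ∀ n : ℕ, Set (SimpleGraph (Fin n))) (γ : ℝ) (hγ : 0 < γ)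
    (hiso : ∀ n, ∀ G ∈ 𝒜 n, ∀ G₂ : SimpleGraph (Fin n), Nonempty (G ≃g G₂) → G₂ ∈ 𝒜 n)
    (hgc : Tendsto (fun n : ℕ => ((Nat.card (𝒜 n) : ℝ) / (Nat.factorial n)) ^ ((1 : ℝ) / n))
      atTop (nhds γ))
    (hba : ∀ n, ∀ G ∈ 𝒜 n, ∀ u v : Fin n,
      G.connectedComponentMk u ≠ G.connectedComponentMk v → addEdge G u v ∈ 𝒜 n)
    (hjoin : ∀ (n : ℕ) (G : SimpleGraph (Fin n)) (S : Finset (Fin n)) (u v : Fin n),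
      u ∈ S → v ∉ S → (∀ x ∈ S, ∀ y, y ∉ S → ¬ G.Adj x y) →
      memClass 𝒜 (G.induce (S : Set (Fin n))) →
      memClass 𝒜 (G.induce ((S : Set (Fin n))ᶜ)) →
      addEdge G u v ∈ 𝒜 n)
    (t : ℕ → ℕ) (htinf : Tendsto t atTop atTop)
    (hto : Tendsto (fun n : ℕ => (t n : ℝ) / n) atTop (nhds 0)) :
    Tendsto (fun n : ℕ =>
      ((Nat.card {G : SimpleGraph (Fin n) // G ∈ 𝒜 n ∧
          ∀ (v : Fin n) (c : G.Walk v v), c.IsCycle → c.length ≤ t n} : ℝ) /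
        (Nat.factorial n)) ^ ((1 : ℝ) / n))
      atTop (nhds γ) := by
  classical
  -- connected graphs are a polynomial fraction
  have hconn : ∀ T n : ℕ, 0 < n → n ≤ T →
      (Nat.card (𝒜 n) : ℝ) ≤ ((n : ℝ) * n + 2) * (B 𝒜 T n).card := by
    intro T n hn hT
    have h := conn_count n (Finset.univ.filter (fun G => G ∈ 𝒜 n)) ⟨0, hn⟩ ?_
    · have e1 : Nat.card (𝒜 n) = (Finset.univ.filter (fun G => G ∈ 𝒜 n)).card := by
        rw [Nat.card_eq_fintype_card, ← Fintype.card_subtype]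
      have e2 : (Finset.univ.filter (fun G => G ∈ 𝒜 n)).filter (fun G => G.Connected) =
          B 𝒜 T n := by
        ext G
        simp [B, cyc_of_le hT G]
      rw [← e1, e2] at h
      exact_mod_cast h
    · intro G hG u v huv
      simp only [Finset.mem_filter, Finset.mem_univ, true_and] at hG ⊢
      exact hba n G hG u v fun h => huv (SimpleGraph.ConnectedComponent.exact h)
  rw [tendsto_order] at hgc ⊢
  obtain ⟨hlow, hup⟩ := hgc
  refine ⟨fun a ha => ?_, fun a ha => ?_⟩
  · obtain ⟨x, hx1, hx2⟩ := exists_between (max_lt ha hγ)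
    obtain ⟨y, hy1, hy2⟩ := exists_between hx2
    have hax : a < x := (le_max_left _ _).trans_lt hx1
    have hx : 0 < x := (le_max_right _ _).trans_lt hx1
    have hy : 0 < y := hx.trans hy1
    obtain ⟨m, hm⟩ := eventually_atTop.1
      (((hlow y hy2).and (poly_exp x y hx hy1)).and (eventually_gt_atTop 0))
    have hm0 : 0 < m := (hm m le_rfl).2
    have hbase : ∀ k, m ≤ k → k ≤ 2 * m →
        2 * x ^ k ≤ ((B 𝒜 (2 * m) k).card : ℝ) / k.factorial := by
      intro k hk hk2
      obtain ⟨⟨h1, h2⟩, h3⟩ := hm k hk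
      have hfac : (0 : ℝ) < k.factorial := by exact_mod_cast k.factorial_pos
      have h4 : y ^ k ≤ (Nat.card (𝒜 k) : ℝ) / k.factorial := by
        have h5 := pow_le_pow_left₀ hy.le h1.le k
        rwa [one_div, Real.rpow_inv_natCast_pow (by positivity) (by omega)] at h5
      have h6 := hconn (2 * m) k h3 hk2
      have hp : (0 : ℝ) < (k : ℝ) * k + 2 := by positivity
      have h7 : (Nat.card (𝒜 k) : ℝ) / k.factorial ≤
          ((B 𝒜 (2 * m) k).card : ℝ) / k.factorial * ((k : ℝ) * k + 2) := by
        rw [div_mul_eq_mul_div]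
        gcongr
        linarith
      exact le_of_mul_le_mul_right (h2.trans (h4.trans h7)) hp
    have hmain := real_core (fun k => ((B 𝒜 (2 * m) k).card : ℝ) / k.factorial) x hx m hm0 hbase
      (fun k hk => join_real (fun k => (B 𝒜 (2 * m) k).card) m k hk
        (join_count 𝒜 hjoin (2 * m) m k hm0 hk))
    filter_upwards [eventually_gt_atTop m, htinf.eventually_ge_atTop (2 * m)] with n hn htn
    refine hax.trans_le ?_
    have h1 := hmain n hn
    have hle : (B 𝒜 (2 * m) n).card ≤ Nat.card {G : SimpleGraph (Fin n) // G ∈ 𝒜 n ∧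
          ∀ (v : Fin n) (c : G.Walk v v), c.IsCycle → c.length ≤ t n} := by
      rw [Nat.card_eq_fintype_card, Fintype.card_subtype]
      apply Finset.card_le_card
      intro G hG
      simp only [B, Finset.mem_filter, Finset.mem_univ, true_and] at hG ⊢
      exact ⟨hG.1, fun v c hc => (hG.2.2 v c hc).trans htn⟩
    have h2 : x ^ n ≤ (Nat.card {G : SimpleGraph (Fin n) // G ∈ 𝒜 n ∧
          ∀ (v : Fin n) (c : G.Walk v v), c.IsCycle → c.length ≤ t n} : ℝ) / n.factorial := by
      refine h1.trans ?_
      have : ((B 𝒜 (2 * m) n).card : ℝ) ≤ _ := Nat.cast_le.2 hle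
      gcongr
    have h3 := Real.rpow_le_rpow (by positivity) h2 (by positivity : (0 : ℝ) ≤ 1 / n)
    rw [one_div, Real.pow_rpow_inv_natCast hx.le (by omega)] at h3
    rwa [one_div]
  · filter_upwards [hup a ha] with n hn
    refine lt_of_le_of_lt ?_ hn
    have hle : Nat.card {G : SimpleGraph (Fin n) // G ∈ 𝒜 n ∧
          ∀ (v : Fin n) (c : G.Walk v v), c.IsCycle → c.length ≤ t n} ≤ Nat.card (𝒜 n) :=
      Nat.card_le_card_of_injective (fun G => (⟨G.1, G.2.1⟩ : 𝒜 n))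
        (fun G G' h => Subtype.ext (congrArg (fun z : 𝒜 n => z.1) h))
    have : (Nat.card {G : SimpleGraph (Fin n) // G ∈ 𝒜 n ∧
          ∀ (v : Fin n) (c : G.Walk v v), c.IsCycle → c.length ≤ t n} : ℝ) ≤ _ := Nat.cast_le.2 hle
    gcongr
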